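/- arXiv:2312.14786 — 6 statements merged into one kernel-verified Lean document; each statement's English description precedes it below -/
import Mathlib

section
/- Let A be a real symmetric n×n matrix with eigenvalues λ₁, …, λₙ ordered so that |λ₁| > |λ₂| ≥ … ≥ |λₙ|, and let v₁, …, vₙ be a corresponding orthonormal basis of eigenvectors. Let x₀ ∈ ℝⁿ be a unit vector with ⟨v₁, x₀⟩ ≠ 0, and set cos θ₀ = |⟨v₁, x₀⟩| with θ₀ ∈ [0, π/2). For each k ∈ ℕ the vector x_k = A^k x₀ is nonzero, and the Rayleigh quotient λ^{(k)} = ⟨x_k, A x_k⟩ / ‖x_k‖² satisfies |λ^{(k)} − λ₁| ≤ (max_{2 ≤ i ≤ n} |λ₁ − λᵢ|) · tan²θ₀ · (|λ₂|/|λ₁|)^{2k}. -/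
open scoped InnerProductSpace

/-- A Rayleigh quotient with weights `(lam i ^ k * c i) ^ 2` differs from `lam a` by at most the
spread `M` times the relative weight off the index `a`. -/
theorem abs_weighted_mean_sub_le {ι : Type*} [Fintype ι] [DecidableEq ι] (lam c : ι → ℝ) (a : ι)
    {r M : ℝ} (k : ℕ) (hlam : lam a ≠ 0) (hca : c a ≠ 0) (hc : ∑ i, c i ^ 2 = 1)
    (hr : ∀ i, i ≠ a → |lam i| ≤ r) (hM : ∀ i, i ≠ a → |lam a - lam i| ≤ M) (hM0 : 0 ≤ M) :
    |(∑ i, lam i * (lam i ^ k * c i) ^ 2) / (∑ i, (lam i ^ k * c i) ^ 2) - lam a| ≤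
      M * ((1 - c a ^ 2) / c a ^ 2) * (r / |lam a|) ^ (2 * k) := by
  set w : ι → ℝ := fun i => (lam i ^ k * c i) ^ 2 with hw
  have hw0 : ∀ i, 0 ≤ w i := fun i => sq_nonneg _
  have hwa : 0 < w a := by simp only [hw]; positivity
  have hSa : w a ≤ ∑ i, w i := Finset.single_le_sum (fun i _ => hw0 i) (Finset.mem_univ a)
  have hS : 0 < ∑ i, w i := hwa.trans_le hSa
  have hterm : ∀ i ∈ Finset.univ.erase a,
      |(lam i - lam a) * w i| ≤ M * (r ^ (2 * k) * c i ^ 2) := by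
    intro i hi
    have hia := Finset.ne_of_mem_erase hi
    have h1 : w i ≤ r ^ (2 * k) * c i ^ 2 := by
      have : w i = |lam i| ^ (2 * k) * c i ^ 2 := by
        simp only [hw]
        rw [pow_mul, sq_abs]
        ring
      rw [this]
      gcongr
      exact hr i hia
    rw [abs_mul, abs_of_nonneg (hw0 i), abs_sub_comm]
    exact mul_le_mul (hM i hia) h1 (hw0 i) hM0
  have hc' : ∑ i ∈ Finset.univ.erase a, c i ^ 2 = 1 - c a ^ 2 := by
    rw [← hc, ← Finset.add_sum_erase _ _ (Finset.mem_univ a)]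
    ring
  have hnum : |∑ i, (lam i - lam a) * w i| ≤ M * (r ^ (2 * k) * (1 - c a ^ 2)) := by
    rw [← Finset.add_sum_erase _ _ (Finset.mem_univ a), sub_self, zero_mul, zero_add, ← hc',
      Finset.mul_sum, Finset.mul_sum]
    exact (Finset.abs_sum_le_sum_abs _ _).trans (Finset.sum_le_sum hterm)
  have hquot : (∑ i, lam i * w i) / (∑ i, w i) - lam a =
      (∑ i, (lam i - lam a) * w i) / ∑ i, w i := by
    simp only [sub_mul, Finset.sum_sub_distrib, ← Finset.mul_sum]
    field_simp
  have hwa' : w a = |lam a| ^ (2 * k) * c a ^ 2 := by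
    simp only [hw]
    rw [pow_mul, sq_abs]
    ring
  change |(∑ i, lam i * w i) / (∑ i, w i) - lam a| ≤ _
  rw [hquot, abs_div, abs_of_pos hS]
  calc _ ≤ M * (r ^ (2 * k) * (1 - c a ^ 2)) / w a :=
        div_le_div₀ ((abs_nonneg _).trans hnum) hnum hwa hSa
    _ = _ := by
        rw [hwa', div_pow]
        have := abs_pos.mpr hlam
        field_simp

/-- Coordinates of `A ^ k x` along an eigenvector of a symmetric matrix `A`. -/
theorem inner_toEuclideanLin_pow_of_eigenvector {ι : Type*} [Fintype ι] [DecidableEq ι]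
    {A : Matrix ι ι ℝ} (hA : A.IsSymm) {μ : ℝ} {u : EuclideanSpace ℝ ι}
    (hu : Matrix.toEuclideanLin A u = μ • u) (x : EuclideanSpace ℝ ι) (k : ℕ) :
    ⟪u, Matrix.toEuclideanLin (A ^ k) x⟫_ℝ = μ ^ k * ⟪u, x⟫_ℝ := by
  have hsymm : (Matrix.toEuclideanLin A).IsSymmetric :=
    Matrix.isSymmetric_toEuclideanLin_iff.mpr (by
      rwa [Matrix.IsHermitian, Matrix.conjTranspose_eq_transpose_of_trivial])
  induction k with
  | zero => simp [Matrix.toLpLin_one]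
  | succ k ih =>
    have hmul : Matrix.toEuclideanLin (A ^ (k + 1)) x =
        Matrix.toEuclideanLin A (Matrix.toEuclideanLin (A ^ k) x) := by
      simp [Matrix.toLpLin_apply, pow_succ']
    rw [hmul, ← hsymm, hu, real_inner_smul_left, ih]
    ring

/-- Error bound for the classical power method.  `A` is real symmetric with
orthonormal eigenbasis `v` and eigenvalues `λ` ordered so that
`|λ 0| > |λ 1| ≥ … ≥ |λ (n+1)|`.  For a unit vector `x₀` with `⟨v 0, x₀⟩ ≠ 0` and
`cos θ₀ = |⟨v 0, x₀⟩|`, `θ₀ ∈ [0, π/2)`, the iterate `x_k = A^k x₀` is nonzero and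
its Rayleigh quotient satisfies
`|λ^{(k)} - λ 0| ≤ (max_{i ≠ 0} |λ 0 - λ i|) · tan²θ₀ · (|λ 1|/|λ 0|)^{2k}`. -/
theorem power_method_error_bound
    {n : ℕ} (A : Matrix (Fin (n + 2)) (Fin (n + 2)) ℝ) (hA : A.IsSymm)
    (lam : Fin (n + 2) → ℝ) (v : Fin (n + 2) → EuclideanSpace ℝ (Fin (n + 2)))
    (hortho : Orthonormal ℝ v)
    (heig : ∀ i, Matrix.toEuclideanLin A (v i) = lam i • v i)
    (horder : Antitone fun i => |lam i|)
    (hstrict : |lam 1| < |lam 0|)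
    (x₀ : EuclideanSpace ℝ (Fin (n + 2))) (hx₀ : ‖x₀‖ = 1)
    (hoverlap : ⟪v 0, x₀⟫_ℝ ≠ 0)
    (θ₀ : ℝ) (hθ₀ : θ₀ ∈ Set.Ico 0 (Real.pi / 2))
    (hcos : Real.cos θ₀ = |⟪v 0, x₀⟫_ℝ|)
    (k : ℕ) :
    Matrix.toEuclideanLin (A ^ k) x₀ ≠ 0 ∧
      |⟪Matrix.toEuclideanLin (A ^ k) x₀,
          Matrix.toEuclideanLin A (Matrix.toEuclideanLin (A ^ k) x₀)⟫_ℝ /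
            ‖Matrix.toEuclideanLin (A ^ k) x₀‖ ^ 2 - lam 0| ≤
        (⨆ i : {i : Fin (n + 2) // i ≠ 0}, |lam 0 - lam i.1|) *
          Real.tan θ₀ ^ 2 * (|lam 1| / |lam 0|) ^ (2 * k) := by
  have hspan : Fintype.card (Fin (n + 2)) =
      Module.finrank ℝ (EuclideanSpace ℝ (Fin (n + 2))) := by simp
  let b : OrthonormalBasis (Fin (n + 2)) ℝ (EuclideanSpace ℝ (Fin (n + 2))) :=
    (basisOfOrthonormalOfCardEqFinrank hortho hspan).toOrthonormalBasis (by simpa using hortho)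
  have hb : ∀ i, b i = v i := fun i => by simp [b]
  have hlam0 : lam 0 ≠ 0 := abs_pos.mp ((abs_nonneg _).trans_lt hstrict)
  have hcoord : ∀ i, ⟪v i, Matrix.toEuclideanLin (A ^ k) x₀⟫_ℝ = lam i ^ k * ⟪v i, x₀⟫_ℝ :=
    fun i => inner_toEuclideanLin_pow_of_eigenvector hA (heig i) x₀ k
  set y := Matrix.toEuclideanLin (A ^ k) x₀ with hy
  refine ⟨fun h => ?_, ?_⟩
  · have := hcoord 0
    rw [h, inner_zero_right] at this
    exact mul_ne_zero (pow_ne_zero k hlam0) hoverlap this.symm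
  have hnorm : ∀ z : EuclideanSpace ℝ (Fin (n + 2)), ‖z‖ ^ 2 = ∑ i, ⟪v i, z⟫_ℝ ^ 2 := fun z => by
    simp [← b.sum_sq_norm_inner_right z, hb]
  have hinner : ⟪y, Matrix.toEuclideanLin A y⟫_ℝ =
      ∑ i, lam i * (lam i ^ k * ⟪v i, x₀⟫_ℝ) ^ 2 := by
    rw [← b.sum_inner_mul_inner]
    refine Finset.sum_congr rfl fun i _ => ?_
    have hAy := inner_toEuclideanLin_pow_of_eigenvector hA (heig i) y 1
    rw [pow_one, pow_one] at hAy
    rw [hb, hAy, real_inner_comm, hcoord]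
    ring
  have htan : Real.tan θ₀ ^ 2 = (1 - ⟪v 0, x₀⟫_ℝ ^ 2) / ⟪v 0, x₀⟫_ℝ ^ 2 := by
    rw [Real.tan_eq_sin_div_cos, div_pow, Real.sin_sq, hcos, sq_abs]
  rw [hinner, hnorm y, htan]
  simp only [hcoord]
  refine abs_weighted_mean_sub_le lam (fun i => ⟪v i, x₀⟫_ℝ) 0 k hlam0 hoverlap
    (by rw [← hnorm, hx₀, one_pow]) (fun i hi => horder (Fin.one_le_of_ne_zero hi))
    (fun i hi => ?_) (Real.iSup_nonneg fun _ => abs_nonneg _)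
  exact le_ciSup (f := fun i : {i : Fin (n + 2) // i ≠ 0} => |lam 0 - lam i.1|)
    (Set.finite_range _).bddAbove ⟨i, hi⟩
end

section
/- For every x ∈ ℂⁿ, ((x x*)^{⊗(p−1)} ⊗ Iₙ) · M_D · ((x x*)^{⊗(p−1)} ⊗ Iₙ) = (x x*)^{⊗(p−1)} ⊗ D(x), where x x* denotes the rank-one n×n matrix with entries xᵢ x̄ⱼ and Iₙ is the n×n identity matrix. -/
open Matrix
open scoped Kronecker

/-- The `p`-fold tensor (Kronecker) power of the rank-one matrix `x x*`,
as a matrix indexed by `Fin p → Fin n`. -/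
noncomputable def rankOnePow (n p : ℕ) (x : Fin n → ℂ) :
    Matrix (Fin p → Fin n) (Fin p → Fin n) ℂ :=
  Matrix.of fun f g => ∏ t, x (f t) * star (x (g t))

/-- `M_D = Σ_{α} Σ_{m} (⊗_{i ≠ m} A_i^α) ⊗ A_m^α`, with the factor `A_m^α` placed in
the last tensor slot and the remaining factors `A_i^α`, `i ≠ m`, in increasing
order of `i` (realized by `Fin.succAbove`).  There are `p + 1` factors. -/
noncomputable def MD (n p K : ℕ)
    (A : Fin K → Fin (p + 1) → Matrix (Fin n) (Fin n) ℂ) :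
    Matrix ((Fin p → Fin n) × Fin n) ((Fin p → Fin n) × Fin n) ℂ :=
  ∑ α, ∑ m : Fin (p + 1),
    (Matrix.of fun f g : Fin p → Fin n =>
      ∏ t, A α (m.succAbove t) (f t) (g t)) ⊗ₖ A α m

/-- The gradient operator `D(x) = Σ_α Σ_m (∏_{i ≠ m} ⟨x, A_i^α x⟩) A_m^α`. -/
noncomputable def gradOp (n p K : ℕ)
    (A : Fin K → Fin (p + 1) → Matrix (Fin n) (Fin n) ℂ) (x : Fin n → ℂ) :
    Matrix (Fin n) (Fin n) ℂ :=
  ∑ α, ∑ m : Fin (p + 1),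
    (∏ t : Fin p, star x ⬝ᵥ (A α (m.succAbove t)).mulVec x) • A α m

/-- The Kronecker product `⊗ₜ B t` of a family of matrices, indexed by functions. -/
def piKronecker {ι m R : Type*} [Fintype ι] [CommMonoid R] (B : ι → Matrix m m R) :
    Matrix (ι → m) (ι → m) R :=
  Matrix.of fun f g => ∏ t, B t (f t) (g t)

theorem piKronecker_mul {ι m R : Type*} [Fintype ι] [DecidableEq ι] [Fintype m] [CommSemiring R]
    (B C : ι → Matrix m m R) :
    piKronecker B * piKronecker C = piKronecker fun t => B t * C t := by
  ext f g
  simp only [piKronecker, Matrix.mul_apply, Matrix.of_apply, ← Finset.prod_mul_distrib,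
    Fintype.prod_sum]

theorem piKronecker_smul {ι m R : Type*} [Fintype ι] [CommSemiring R]
    (c : ι → R) (B : ι → Matrix m m R) :
    piKronecker (fun t => c t • B t) = (∏ t, c t) • piKronecker B := by
  ext f g
  simp [piKronecker, Finset.prod_mul_distrib]

theorem vecMulVec_mul_mul_vecMulVec {m R : Type*} [Fintype m] [CommSemiring R]
    (u v w z : m → R) (B : Matrix m m R) :
    vecMulVec u v * B * vecMulVec w z = (v ⬝ᵥ B *ᵥ w) • vecMulVec u z := by
  rw [Matrix.mul_assoc, mul_vecMulVec, vecMulVec_mul_vecMulVec]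
  ext i j
  simp [vecMulVec_apply, mul_left_comm]

theorem rankOnePow_mul_piKronecker_mul_rankOnePow (n p : ℕ) (x : Fin n → ℂ)
    (B : Fin p → Matrix (Fin n) (Fin n) ℂ) :
    rankOnePow n p x * piKronecker B * rankOnePow n p x =
      (∏ t, star x ⬝ᵥ B t *ᵥ x) • rankOnePow n p x := by
  have h : rankOnePow n p x = piKronecker fun _ => vecMulVec x (star x) := rfl
  simp only [h, piKronecker_mul, vecMulVec_mul_mul_vecMulVec, piKronecker_smul]

/-- `((x x*)^{⊗ p} ⊗ Iₙ) · M_D · ((x x*)^{⊗ p} ⊗ Iₙ) = (x x*)^{⊗ p} ⊗ D(x)`,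
where there are `p + 1` tensor factors in total. -/
theorem rankOnePow_mul_MD_mul_rankOnePow (n p K : ℕ)
    (A : Fin K → Fin (p + 1) → Matrix (Fin n) (Fin n) ℂ) (x : Fin n → ℂ) :
    (rankOnePow n p x ⊗ₖ (1 : Matrix (Fin n) (Fin n) ℂ)) * MD n p K A *
        (rankOnePow n p x ⊗ₖ (1 : Matrix (Fin n) (Fin n) ℂ)) =
      rankOnePow n p x ⊗ₖ gradOp n p K A x := by
  simp only [MD, gradOp, Matrix.mul_sum, Matrix.sum_mul]
  ext i j
  simp only [Matrix.sum_apply, kroneckerMap_apply, Finset.mul_sum, ← mul_kronecker_mul,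
    one_mul, mul_one]
  refine Finset.sum_congr rfl fun α _ => Finset.sum_congr rfl fun m _ => ?_
  have h := rankOnePow_mul_piKronecker_mul_rankOnePow n p x fun t => A α (m.succAbove t)
  rw [piKronecker] at h
  rw [h]
  simp only [Matrix.smul_apply, smul_eq_mul]
  ring
end

section
/- Let U₁ and U₂ be unitary matrices on ℂ^m ⊗ ℂⁿ that are block encodings of the n×n matrices A₁ and A₂ respectively. Let S be the unitary on ℂ^m ⊗ ℂ^m that swaps the two tensor factors. Then the unitary W = (I_m ⊗ U₂)(S ⊗ Iₙ)(I_m ⊗ U₁) on ℂ^m ⊗ ℂ^m ⊗ ℂⁿ is a block encoding of the product A₂A₁; that is, (⟨0| ⊗ ⟨0| ⊗ Iₙ) W (|0⟩ ⊗ |0⟩ ⊗ Iₙ) = A₂A₁. -/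
/-- `U` (a matrix on `ℂ^m ⊗ ℂⁿ`) is a block encoding of the `n×n` matrix `A`:
`(⟨0| ⊗ Iₙ) U (|0⟩ ⊗ Iₙ) = A`. -/
def IsBlockEncoding {m n : ℕ} [NeZero m]
    (U : Matrix (Fin m × Fin n) (Fin m × Fin n) ℂ)
    (A : Matrix (Fin n) (Fin n) ℂ) : Prop :=
  ∀ i j : Fin n, U (0, i) (0, j) = A i j

/-- `I_m ⊗ U` acting on `ℂ^m ⊗ (ℂ^m ⊗ ℂⁿ)`, applying `U` to the last two factors. -/
noncomputable def idTensor {m n : ℕ}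
    (U : Matrix (Fin m × Fin n) (Fin m × Fin n) ℂ) :
    Matrix (Fin m × Fin m × Fin n) (Fin m × Fin m × Fin n) ℂ :=
  Matrix.of fun p q => (if p.1 = q.1 then (1 : ℂ) else 0) * U p.2 q.2

/-- `S ⊗ Iₙ` on `ℂ^m ⊗ ℂ^m ⊗ ℂⁿ`, where `S` swaps the two `ℂ^m` factors. -/
noncomputable def swapTensorId (m n : ℕ) :
    Matrix (Fin m × Fin m × Fin n) (Fin m × Fin m × Fin n) ℂ :=
  Matrix.of fun p q =>
    if p.1 = q.2.1 ∧ p.2.1 = q.1 ∧ p.2.2 = q.2.2 then (1 : ℂ) else 0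

open scoped Kronecker

theorem idTensor_eq_kronecker {m n : ℕ} (U : Matrix (Fin m × Fin n) (Fin m × Fin n) ℂ) :
    idTensor U = (1 : Matrix (Fin m) (Fin m) ℂ) ⊗ₖ U := by
  ext p q
  simp [idTensor, Matrix.one_apply]

theorem idTensor_mem_unitaryGroup {m n : ℕ} {U : Matrix (Fin m × Fin n) (Fin m × Fin n) ℂ}
    (hU : U ∈ Matrix.unitaryGroup (Fin m × Fin n) ℂ) :
    idTensor U ∈ Matrix.unitaryGroup (Fin m × Fin m × Fin n) ℂ := by
  rw [idTensor_eq_kronecker]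
  exact Matrix.kronecker_mem_unitary (one_mem _) hU

theorem swapTensorId_mul_apply {m n : ℕ} {κ : Type*}
    (M : Matrix (Fin m × Fin m × Fin n) κ ℂ) (a b : Fin m) (k : Fin n) (q : κ) :
    (swapTensorId m n * M) (a, b, k) q = M (b, a, k) q := by
  rw [Matrix.mul_apply, Finset.sum_eq_single (b, a, k)]
  · simp [swapTensorId]
  · rintro ⟨c, d, l⟩ - h
    have h' : ¬(a = d ∧ b = c ∧ k = l) := by
      rintro ⟨rfl, rfl, rfl⟩
      exact h rfl
    simp [swapTensorId, h']
  · simp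

theorem star_swapTensorId (m n : ℕ) : star (swapTensorId m n) = swapTensorId m n := by
  ext ⟨a, b, k⟩ ⟨c, d, l⟩
  simp only [swapTensorId, Matrix.star_apply, Matrix.of_apply, apply_ite star, star_one,
    star_zero]
  congr 1
  grind

theorem swapTensorId_mul_self (m n : ℕ) : swapTensorId m n * swapTensorId m n = 1 := by
  ext ⟨a, b, k⟩ ⟨c, d, l⟩
  rw [swapTensorId_mul_apply]
  simp only [swapTensorId, Matrix.of_apply, Matrix.one_apply, Prod.mk.injEq]
  congr 1
  grind

theorem swapTensorId_mem_unitaryGroup (m n : ℕ) :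
    swapTensorId m n ∈ Matrix.unitaryGroup (Fin m × Fin m × Fin n) ℂ := by
  rw [Matrix.mem_unitaryGroup_iff, star_swapTensorId, swapTensorId_mul_self]

/-- Block encoding of a product: if `U₁, U₂` are unitary block encodings of
`A₁, A₂`, then `W = (I_m ⊗ U₂)(S ⊗ Iₙ)(I_m ⊗ U₁)` is a unitary block encoding of
`A₂ A₁`: `(⟨0| ⊗ ⟨0| ⊗ Iₙ) W (|0⟩ ⊗ |0⟩ ⊗ Iₙ) = A₂ A₁`. -/
theorem blockEncoding_product {m n : ℕ} [NeZero m]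
    (U₁ U₂ : Matrix (Fin m × Fin n) (Fin m × Fin n) ℂ)
    (hU₁ : U₁ ∈ Matrix.unitaryGroup (Fin m × Fin n) ℂ)
    (hU₂ : U₂ ∈ Matrix.unitaryGroup (Fin m × Fin n) ℂ)
    (A₁ A₂ : Matrix (Fin n) (Fin n) ℂ)
    (hA₁ : IsBlockEncoding U₁ A₁) (hA₂ : IsBlockEncoding U₂ A₂) :
    idTensor U₂ * swapTensorId m n * idTensor U₁ ∈
        Matrix.unitaryGroup (Fin m × Fin m × Fin n) ℂ ∧
      ∀ i j : Fin n,
        (idTensor U₂ * swapTensorId m n * idTensor U₁) (0, 0, i) (0, 0, j) =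
          (A₂ * A₁) i j := by
  refine ⟨mul_mem (mul_mem (idTensor_mem_unitaryGroup hU₂) (swapTensorId_mem_unitaryGroup m n))
    (idTensor_mem_unitaryGroup hU₁), fun i j => ?_⟩
  rw [Matrix.mul_assoc, Matrix.mul_apply, Matrix.mul_apply, Fintype.sum_prod_type]
  simp only [Fintype.sum_prod_type, swapTensorId_mul_apply]
  rw [Finset.sum_eq_single 0, Finset.sum_eq_single 0]
  · simp [idTensor, hA₁ _ _, hA₂ _ _]
  · intro b _ hb
    simp [idTensor, hb]
  · simp
  · intro a _ ha
    simp [idTensor, ha.symm]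
  · simp
end

section
/- Let U be a unitary on ℂ^m ⊗ ℂⁿ, let |Φ⟩ = U(|0⟩ ⊗ |0⟩), and let ρ = Tr_{ℂ^m}(|Φ⟩⟨Φ|) be the n×n density matrix obtained by tracing out the first factor. Let S be the unitary on ℂⁿ ⊗ ℂⁿ that swaps the two tensor factors. Then the unitary W = (U† ⊗ Iₙ)(I_m ⊗ S)(U ⊗ Iₙ) on ℂ^m ⊗ ℂⁿ ⊗ ℂⁿ is an exact block encoding of ρ with the first two factors as ancilla; that is, (⟨0| ⊗ ⟨0| ⊗ Iₙ) W (|0⟩ ⊗ |0⟩ ⊗ Iₙ) = ρ. -/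
open Matrix
/-- `V ⊗ Iₙ` on `ℂ^m ⊗ ℂⁿ ⊗ ℂⁿ`, applying `V` to the first two factors. -/
noncomputable def tensorId {m n : ℕ}
    (V : Matrix (Fin m × Fin n) (Fin m × Fin n) ℂ) :
    Matrix (Fin m × Fin n × Fin n) (Fin m × Fin n × Fin n) ℂ :=
  Matrix.of fun p q =>
    V (p.1, p.2.1) (q.1, q.2.1) * (if p.2.2 = q.2.2 then (1 : ℂ) else 0)

/-- `I_m ⊗ S` on `ℂ^m ⊗ ℂⁿ ⊗ ℂⁿ`, where `S` swaps the two `ℂⁿ` factors. -/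
noncomputable def idTensorSwap (m n : ℕ) :
    Matrix (Fin m × Fin n × Fin n) (Fin m × Fin n × Fin n) ℂ :=
  Matrix.of fun p q =>
    if p.1 = q.1 ∧ p.2.1 = q.2.2 ∧ p.2.2 = q.2.1 then (1 : ℂ) else 0

theorem tensorId_one {m n : ℕ} :
    tensorId (1 : Matrix (Fin m × Fin n) (Fin m × Fin n) ℂ) = 1 := by
  ext ⟨a, b, c⟩ ⟨a', b', c'⟩
  simp only [tensorId, Matrix.of_apply, Matrix.one_apply, Prod.mk.injEq, ← ite_and, mul_ite,
    mul_one, mul_zero]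
  congr 1
  simp only [eq_iff_iff]
  tauto

theorem tensorId_mul {m n : ℕ} (V W : Matrix (Fin m × Fin n) (Fin m × Fin n) ℂ) :
    tensorId V * tensorId W = tensorId (V * W) := by
  ext ⟨a, b, c⟩ ⟨a', b', c'⟩
  simp [tensorId, Matrix.mul_apply, Fintype.sum_prod_type]

theorem tensorId_conjTranspose {m n : ℕ} (V : Matrix (Fin m × Fin n) (Fin m × Fin n) ℂ) :
    (tensorId V)ᴴ = tensorId Vᴴ := by
  ext ⟨a, b, c⟩ ⟨a', b', c'⟩
  simp only [tensorId, Matrix.conjTranspose_apply, Matrix.of_apply, star_mul', apply_ite star,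
    star_one, star_zero, eq_comm (a := c)]

theorem tensorId_mem_unitaryGroup {m n : ℕ} {V : Matrix (Fin m × Fin n) (Fin m × Fin n) ℂ}
    (hV : V ∈ Matrix.unitaryGroup (Fin m × Fin n) ℂ) :
    tensorId V ∈ Matrix.unitaryGroup (Fin m × Fin n × Fin n) ℂ := by
  rw [Matrix.mem_unitaryGroup_iff, Matrix.star_eq_conjTranspose] at hV ⊢
  rw [tensorId_conjTranspose, tensorId_mul, hV, tensorId_one]

theorem idTensorSwap_mul_apply {m n : ℕ} {κ : Type*}
    (M : Matrix (Fin m × Fin n × Fin n) κ ℂ) (a : Fin m) (b c : Fin n) (q : κ) :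
    (idTensorSwap m n * M) (a, b, c) q = M (a, c, b) q := by
  rw [Matrix.mul_apply, Finset.sum_eq_single (a, c, b)]
  · simp [idTensorSwap]
  · rintro ⟨a', b', c'⟩ - h
    have h' : ¬(a = a' ∧ b = c' ∧ c = b') := by
      rintro ⟨rfl, rfl, rfl⟩
      exact h rfl
    simp [idTensorSwap, h']
  · simp

theorem idTensorSwap_conjTranspose (m n : ℕ) : (idTensorSwap m n)ᴴ = idTensorSwap m n := by
  ext ⟨a, b, c⟩ ⟨a', b', c'⟩
  simp only [idTensorSwap, Matrix.conjTranspose_apply, Matrix.of_apply, apply_ite star, star_one,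
    star_zero]
  congr 1
  simp only [eq_iff_iff]
  grind

theorem idTensorSwap_mem_unitaryGroup (m n : ℕ) :
    idTensorSwap m n ∈ Matrix.unitaryGroup (Fin m × Fin n × Fin n) ℂ := by
  rw [Matrix.mem_unitaryGroup_iff, Matrix.star_eq_conjTranspose, idTensorSwap_conjTranspose]
  ext ⟨a, b, c⟩ ⟨a', b', c'⟩
  rw [idTensorSwap_mul_apply]
  simp only [idTensorSwap, Matrix.of_apply, Matrix.one_apply, Prod.mk.injEq]
  congr 1
  simp only [eq_iff_iff]
  tauto

/-- Block encoding of a density matrix: let `U` be unitary on `ℂ^m ⊗ ℂⁿ`, let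
`|Φ⟩ = U(|0⟩ ⊗ |0⟩)` and `ρ = Tr_{ℂ^m}(|Φ⟩⟨Φ|)` (so `ρ_{b b'} = Σ_a Φ_{ab} Φ̄_{ab'}`).
Then `W = (U† ⊗ Iₙ)(I_m ⊗ S)(U ⊗ Iₙ)` is an exact unitary block encoding of `ρ`
with the first two factors as ancilla:
`(⟨0| ⊗ ⟨0| ⊗ Iₙ) W (|0⟩ ⊗ |0⟩ ⊗ Iₙ) = ρ`. -/
theorem blockEncoding_density_matrix {m n : ℕ} [NeZero m] [NeZero n]
    (U : Matrix (Fin m × Fin n) (Fin m × Fin n) ℂ)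
    (hU : U ∈ Matrix.unitaryGroup (Fin m × Fin n) ℂ)
    (Φ : Fin m × Fin n → ℂ) (hΦ : Φ = fun p => U p (0, 0))
    (ρ : Matrix (Fin n) (Fin n) ℂ)
    (hρ : ρ = Matrix.of fun b b' => ∑ a : Fin m, Φ (a, b) * star (Φ (a, b'))) :
    tensorId Uᴴ * idTensorSwap m n * tensorId U ∈
        Matrix.unitaryGroup (Fin m × Fin n × Fin n) ℂ ∧
      ∀ i j : Fin n,
        (tensorId Uᴴ * idTensorSwap m n * tensorId U) (0, 0, i) (0, 0, j) = ρ i j := by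
  refine ⟨mul_mem (mul_mem (tensorId_mem_unitaryGroup (Unitary.star_mem hU))
    (idTensorSwap_mem_unitaryGroup m n)) (tensorId_mem_unitaryGroup hU), fun i j => ?_⟩
  subst hρ hΦ
  rw [Matrix.mul_assoc, Matrix.mul_apply]
  simp only [Fintype.sum_prod_type, idTensorSwap_mul_apply]
  simp [tensorId, mul_comm]
end

section
/- Let U₁ be a unitary on ℂ^{m₁} ⊗ ℂ^{n₁} that block-encodes the n₁×n₁ matrix M₁ and let U₂ be a unitary on ℂ^{m₂} ⊗ ℂ^{n₂} that block-encodes the n₂×n₂ matrix M₂. Let P : ℂ^{m₁} ⊗ ℂ^{m₂} ⊗ ℂ^{n₁} ⊗ ℂ^{n₂} → ℂ^{m₁} ⊗ ℂ^{n₁} ⊗ ℂ^{m₂} ⊗ ℂ^{n₂} be the permutation unitary with P(a ⊗ b ⊗ c ⊗ d) = a ⊗ c ⊗ b ⊗ d. Then W = P† (U₁ ⊗ U₂) P is a unitary block encoding of M₁ ⊗ M₂; that is, (⟨0| ⊗ ⟨0| ⊗ I_{n₁} ⊗ I_{n₂}) W (|0⟩ ⊗ |0⟩ ⊗ I_{n₁}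 ⊗ I_{n₂}) = M₁ ⊗ M₂. -/
open Matrix
open scoped Kronecker

/-- The permutation matrix `P : ℂ^{m₁} ⊗ ℂ^{m₂} ⊗ ℂ^{n₁} ⊗ ℂ^{n₂} →
ℂ^{m₁} ⊗ ℂ^{n₁} ⊗ ℂ^{m₂} ⊗ ℂ^{n₂}` with `P(a ⊗ b ⊗ c ⊗ d) = a ⊗ c ⊗ b ⊗ d`. -/
noncomputable def midSwapPerm (m₁ n₁ m₂ n₂ : ℕ) :
    Matrix ((Fin m₁ × Fin n₁) × (Fin m₂ × Fin n₂))
      ((Fin m₁ × Fin m₂) × (Fin n₁ × Fin n₂)) ℂ :=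
  Matrix.of fun p q =>
    if p.1.1 = q.1.1 ∧ p.2.1 = q.1.2 ∧ p.1.2 = q.2.1 ∧ p.2.2 = q.2.2
    then (1 : ℂ) else 0

/-- `midSwapPerm` is the identity matrix with its columns relabelled by `Equiv.prodProdProdComm`. -/
theorem midSwapPerm_eq_submatrix_one (m₁ n₁ m₂ n₂ : ℕ) :
    midSwapPerm m₁ n₁ m₂ n₂ =
      (1 : Matrix ((Fin m₁ × Fin n₁) × (Fin m₂ × Fin n₂)) _ ℂ).submatrix id
        (Equiv.prodProdProdComm (Fin m₁) (Fin m₂) (Fin n₁) (Fin n₂)) := by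
  ext ⟨⟨a, c⟩, b, d⟩ ⟨⟨a', b'⟩, c', d'⟩
  simp only [midSwapPerm, of_apply, submatrix_apply, one_apply, id_eq,
    Equiv.prodProdProdComm_apply, Prod.mk.injEq]
  congr 1
  exact propext (by tauto)

/-- Conjugation by `midSwapPerm` relabels rows and columns. -/
theorem conjTranspose_midSwapPerm_mul_mul {m₁ n₁ m₂ n₂ : ℕ}
    (A : Matrix ((Fin m₁ × Fin n₁) × (Fin m₂ × Fin n₂))
      ((Fin m₁ × Fin n₁) × (Fin m₂ × Fin n₂)) ℂ) :
    (midSwapPerm m₁ n₁ m₂ n₂)ᴴ * A * midSwapPerm m₁ n₁ m₂ n₂ =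
      A.submatrix (Equiv.prodProdProdComm (Fin m₁) (Fin m₂) (Fin n₁) (Fin n₂))
        (Equiv.prodProdProdComm (Fin m₁) (Fin m₂) (Fin n₁) (Fin n₂)) := by
  ext p q
  simp [midSwapPerm_eq_submatrix_one, mul_apply, one_apply]

/-- Relabelling rows and columns by the same equivalence preserves unitarity. -/
theorem submatrix_equiv_mem_unitaryGroup {ι κ : Type*} [Fintype ι] [DecidableEq ι] [Fintype κ]
    [DecidableEq κ] {A : Matrix ι ι ℂ} (hA : A ∈ unitaryGroup ι ℂ) (e : κ ≃ ι) :
    A.submatrix e e ∈ unitaryGroup κ ℂ := by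
  rw [mem_unitaryGroup_iff, star_eq_conjTranspose] at hA ⊢
  rw [conjTranspose_submatrix, submatrix_mul_equiv, hA, submatrix_one_equiv]

/-- Block encoding of a tensor product: if `U₁` block-encodes `M₁` and `U₂`
block-encodes `M₂`, then `W = P† (U₁ ⊗ U₂) P` is a unitary block encoding of
`M₁ ⊗ M₂`: `(⟨0| ⊗ ⟨0| ⊗ I_{n₁} ⊗ I_{n₂}) W (|0⟩ ⊗ |0⟩ ⊗ I_{n₁} ⊗ I_{n₂}) = M₁ ⊗ M₂`. -/
theorem blockEncoding_kronecker {m₁ n₁ m₂ n₂ : ℕ} [NeZero m₁] [NeZero m₂]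
    (U₁ : Matrix (Fin m₁ × Fin n₁) (Fin m₁ × Fin n₁) ℂ)
    (U₂ : Matrix (Fin m₂ × Fin n₂) (Fin m₂ × Fin n₂) ℂ)
    (hU₁ : U₁ ∈ Matrix.unitaryGroup (Fin m₁ × Fin n₁) ℂ)
    (hU₂ : U₂ ∈ Matrix.unitaryGroup (Fin m₂ × Fin n₂) ℂ)
    (M₁ : Matrix (Fin n₁) (Fin n₁) ℂ) (M₂ : Matrix (Fin n₂) (Fin n₂) ℂ)
    (hM₁ : ∀ i j : Fin n₁, U₁ (0, i) (0, j) = M₁ i j)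
    (hM₂ : ∀ i j : Fin n₂, U₂ (0, i) (0, j) = M₂ i j) :
    ((midSwapPerm m₁ n₁ m₂ n₂)ᴴ * (U₁ ⊗ₖ U₂) * midSwapPerm m₁ n₁ m₂ n₂) ∈
        Matrix.unitaryGroup ((Fin m₁ × Fin m₂) × (Fin n₁ × Fin n₂)) ℂ ∧
      ∀ (i k : Fin n₁) (j l : Fin n₂),
        ((midSwapPerm m₁ n₁ m₂ n₂)ᴴ * (U₁ ⊗ₖ U₂) * midSwapPerm m₁ n₁ m₂ n₂)
            ((0, 0), (i, j)) ((0, 0), (k, l)) = (M₁ ⊗ₖ M₂) (i, j) (k, l) := by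
  rw [conjTranspose_midSwapPerm_mul_mul]
  refine ⟨submatrix_equiv_mem_unitaryGroup (kronecker_mem_unitary hU₁ hU₂) _, ?_⟩
  intro i k j l
  simp [hM₁, hM₂]
end

section
/- Let A be a real symmetric n×n matrix all of whose eigenvalues lie in the open interval (−1, 1), with eigenvalues λ₁, …, λₙ ordered so that |λ₁| > |λ₂| ≥ … ≥ |λₙ| and |λ₂| > 0, and let v₁, …, vₙ be a corresponding orthonormal basis of eigenvectors. Set Δ = |λ₁| − |λ₂| > 0. Let x₀ ∈ ℝⁿ be a unit vector with ⟨v₁, x₀⟩ ≠ 0 and set cos θ₀ = |⟨v₁, x₀⟩|, θ₀ ∈ [0, π/2). Let δ > 0 and let k be a natural number with 2kΔ ≥ log(2/(δ cos²θ₀)). Then the Rayleigh quotient λ^{(k)} = ⟨x_k, A x_k⟩ / ‖x_k‖² of the power-method iterate x_k = A^k x₀ (which is nonzero) satisfies |λ^{(k)} − λ₁| ≤ δ. -/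
open scoped InnerProductSpace

section Diagonalizable

variable {ι E : Type*} [Fintype ι] [NormedAddCommGroup E] [InnerProductSpace ℝ E]

theorem OrthonormalBasis.inner_map_of_eigenbasis (b : OrthonormalBasis ι ℝ E) {T : E →ₗ[ℝ] E}
    {μ : ι → ℝ} (hT : ∀ i, T (b i) = μ i • b i) (x : E) (i : ι) :
    ⟪b i, T x⟫_ℝ = μ i * ⟪b i, x⟫_ℝ := by
  classical
  conv_lhs => rw [← b.sum_repr' x]
  simp [inner_sum, inner_smul_right, hT, b.inner_eq_ite, mul_comm]

theorem OrthonormalBasis.inner_pow_map_of_eigenbasis (b : OrthonormalBasis ι ℝ E)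
    {T : E →ₗ[ℝ] E} {μ : ι → ℝ} (hT : ∀ i, T (b i) = μ i • b i) (x : E) (k : ℕ) (i : ι) :
    ⟪b i, (T ^ k) x⟫_ℝ = μ i ^ k * ⟪b i, x⟫_ℝ := by
  induction k with
  | zero => simp
  | succ k ih =>
    rw [pow_succ', Module.End.mul_apply, b.inner_map_of_eigenbasis hT, ih, pow_succ', mul_assoc]

/-- The residual of the Rayleigh quotient at `y`, cleared of its denominator. -/
theorem OrthonormalBasis.inner_map_self_sub_of_eigenbasis (b : OrthonormalBasis ι ℝ E)
    {T : E →ₗ[ℝ] E} {μ : ι → ℝ} (hT : ∀ i, T (b i) = μ i • b i) (y : E) (c : ℝ) :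
    ⟪y, T y⟫_ℝ - c * ‖y‖ ^ 2 = ∑ i, (μ i - c) * ⟪b i, y⟫_ℝ ^ 2 := by
  rw [← b.sum_inner_mul_inner, ← b.sum_sq_norm_inner_right y, Finset.mul_sum,
    ← Finset.sum_sub_distrib]
  refine Finset.sum_congr rfl fun i _ => ?_
  rw [b.inner_map_of_eigenbasis hT, real_inner_comm, Real.norm_eq_abs, sq_abs]
  ring

end Diagonalizable

/-- Since `a ≤ 1`, the ratio `r / a` is at most `exp (-(a - r))`. -/
theorem pow_le_exp_neg_mul_sub_mul_pow {r a : ℝ} (hr : 0 ≤ r) (hra : r ≤ a) (ha : a ≤ 1) (m : ℕ) :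
    r ^ m ≤ Real.exp (-(m * (a - r))) * a ^ m := by
  have hexp := Real.add_one_le_exp (-(a - r))
  have h : r ≤ Real.exp (-(a - r)) * a := by
    nlinarith [mul_nonneg (sub_nonneg.2 hra) (sub_nonneg.2 ha),
      mul_le_mul_of_nonneg_right hexp (hr.trans hra)]
  calc r ^ m ≤ (Real.exp (-(a - r)) * a) ^ m := pow_le_pow_left₀ hr h m
    _ = Real.exp (-(m * (a - r))) * a ^ m := by
      rw [mul_pow, ← Real.exp_nat_mul, mul_neg]

/-- Iteration-count guarantee for the power method.  `A` is real symmetric with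
all eigenvalues in `(-1, 1)`, orthonormal eigenbasis `v`, eigenvalues `λ` ordered
so that `|λ 0| > |λ 1| ≥ … ≥ |λ (n+1)|` and `|λ 1| > 0`; set `Δ = |λ 0| - |λ 1|`.
For a unit vector `x₀` with `⟨v 0, x₀⟩ ≠ 0`, `cos θ₀ = |⟨v 0, x₀⟩|`,
`θ₀ ∈ [0, π/2)`, any `δ > 0`, and any `k` with `2kΔ ≥ log (2/(δ cos²θ₀))`, the
power-method iterate `x_k = A^k x₀` is nonzero and its Rayleigh quotient
satisfies `|λ^{(k)} - λ 0| ≤ δ`. -/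
theorem power_method_iteration_guarantee
    {n : ℕ} (A : Matrix (Fin (n + 2)) (Fin (n + 2)) ℝ) (hA : A.IsSymm)
    (lam : Fin (n + 2) → ℝ) (v : Fin (n + 2) → EuclideanSpace ℝ (Fin (n + 2)))
    (hortho : Orthonormal ℝ v)
    (heig : ∀ i, Matrix.toEuclideanLin A (v i) = lam i • v i)
    (hbound : ∀ i, |lam i| < 1)
    (horder : Antitone fun i => |lam i|)
    (hstrict : |lam 1| < |lam 0|) (hlam₂ : 0 < |lam 1|)
    (Δ : ℝ) (hΔ : Δ = |lam 0| - |lam 1|)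
    (x₀ : EuclideanSpace ℝ (Fin (n + 2))) (hx₀ : ‖x₀‖ = 1)
    (hoverlap : ⟪v 0, x₀⟫_ℝ ≠ 0)
    (θ₀ : ℝ) (hθ₀ : θ₀ ∈ Set.Ico 0 (Real.pi / 2))
    (hcos : Real.cos θ₀ = |⟪v 0, x₀⟫_ℝ|)
    (δ : ℝ) (hδ : 0 < δ)
    (k : ℕ) (hk : Real.log (2 / (δ * Real.cos θ₀ ^ 2)) ≤ 2 * k * Δ) :
    Matrix.toEuclideanLin (A ^ k) x₀ ≠ 0 ∧
      |⟪Matrix.toEuclideanLin (A ^ k) x₀,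
          Matrix.toEuclideanLin A (Matrix.toEuclideanLin (A ^ k) x₀)⟫_ℝ /
            ‖Matrix.toEuclideanLin (A ^ k) x₀‖ ^ 2 - lam 0| ≤ δ := by
  obtain ⟨b, hb⟩ : ∃ b : OrthonormalBasis (Fin (n + 2)) ℝ (EuclideanSpace ℝ (Fin (n + 2))),
      ⇑b = v :=
    ⟨OrthonormalBasis.mk hortho
      (hortho.linearIndependent.span_eq_top_of_card_eq_finrank' (by simp)).ge, by simp⟩
  subst hb
  set T := Matrix.toEuclideanLin A
  have hpow : Matrix.toEuclideanLin (A ^ k) = T ^ k := Matrix.toLpLin_pow 2 A k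
  rw [hpow]
  set y := (T ^ k) x₀ with hy
  have hcoord : ∀ i, ⟪b i, y⟫_ℝ ^ 2 = |lam i| ^ (2 * k) * ⟪b i, x₀⟫_ℝ ^ 2 := fun i => by
    rw [hy, b.inner_pow_map_of_eigenbasis heig, mul_pow, pow_mul, sq_abs, ← pow_mul, ← pow_mul,
      mul_comm k 2]
  have hlam₁ : 0 < |lam 0| := hlam₂.trans hstrict
  have hc : 0 < ⟪b 0, x₀⟫_ℝ ^ 2 := by positivity
  have hnorm : |lam 0| ^ (2 * k) * ⟪b 0, x₀⟫_ℝ ^ 2 ≤ ‖y‖ ^ 2 := by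
    rw [← hcoord, ← b.sum_sq_norm_inner_right y]
    simpa using Finset.single_le_sum (f := fun i => ‖⟪b i, y⟫_ℝ‖ ^ 2)
      (fun i _ => sq_nonneg _) (Finset.mem_univ 0)
  have hpos : 0 < ‖y‖ ^ 2 := lt_of_lt_of_le (by positivity) hnorm
  refine ⟨fun h => by simp [h] at hpos, ?_⟩
  have hexp : 2 * Real.exp (-(2 * k * Δ)) ≤ δ * ⟪b 0, x₀⟫_ℝ ^ 2 := by
    rw [hcos, sq_abs, Real.log_le_iff_le_exp (by positivity), div_le_iff₀ (by positivity)] at hk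
    rw [Real.exp_neg, ← div_eq_mul_inv, div_le_iff₀ (Real.exp_pos _)]
    linarith
  have hdecay : 2 * |lam 1| ^ (2 * k) ≤ δ * ‖y‖ ^ 2 := by
    have h := pow_le_exp_neg_mul_sub_mul_pow (abs_nonneg _) hstrict.le (hbound 0).le (2 * k)
    rw [← hΔ] at h
    push_cast at h
    calc 2 * |lam 1| ^ (2 * k) ≤ 2 * Real.exp (-(2 * k * Δ)) * |lam 0| ^ (2 * k) := by linarith
      _ ≤ δ * ⟪b 0, x₀⟫_ℝ ^ 2 * |lam 0| ^ (2 * k) := by gcongr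
      _ = δ * (|lam 0| ^ (2 * k) * ⟪b 0, x₀⟫_ℝ ^ 2) := by ring
      _ ≤ δ * ‖y‖ ^ 2 := by gcongr
  have hterm : ∀ i, |(lam i - lam 0) * ⟪b i, y⟫_ℝ ^ 2| ≤
      2 * |lam 1| ^ (2 * k) * ⟪b i, x₀⟫_ℝ ^ 2 := fun i => by
    rcases eq_or_ne i 0 with rfl | hi
    · simp only [sub_self, zero_mul, abs_zero]
      positivity
    · have hgap : |lam i - lam 0| ≤ 2 := by
        linarith [abs_sub (lam i) (lam 0), hbound i, hbound 0]
      have hle : |lam i| ≤ |lam 1| := horder (Fin.one_le_of_ne_zero hi)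
      rw [abs_mul, abs_sq, hcoord, mul_assoc]
      gcongr
  rw [div_sub' hpos.ne', abs_div, abs_of_pos hpos, div_le_iff₀ hpos, mul_comm (‖y‖ ^ 2),
    b.inner_map_self_sub_of_eigenbasis heig]
  calc |∑ i, (lam i - lam 0) * ⟪b i, y⟫_ℝ ^ 2|
      ≤ ∑ i, 2 * |lam 1| ^ (2 * k) * ⟪b i, x₀⟫_ℝ ^ 2 :=
        (Finset.abs_sum_le_sum_abs _ _).trans (Finset.sum_le_sum fun i _ => hterm i)
    _ = 2 * |lam 1| ^ (2 * k) := by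
      have h := b.sum_sq_norm_inner_right x₀
      simp only [Real.norm_eq_abs, sq_abs] at h
      rw [← Finset.mul_sum, h, hx₀, one_pow, mul_one]
    _ ≤ δ * ‖y‖ ^ 2 := hdecay
end
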